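/- Let ε' > 0 and let w be three times continuously differentiable on an open neighborhood of Ω_{ε'} with D_p w = 0 in the interior of Ω_{ε'}. For 0 < ε ≤ ε', let w_ε be the ε-mean value solution in Ω with boundary data w|_{Γ_ε}. Then there exists a constant C₂ > 0, depending on w, Ω, N and p but independent of ε, such that |w(x) − w_ε(x)| ≤ C₂·ε for all x ∈ closure(Ω) and all 0 < ε ≤ ε'. -/

import Mathlib

open MeasureTheory Metric Set
open scoped ENNReal NNReal Classical

noncomputable section

abbrev EucN (N : ℕ) := EuclideanSpace ℝ (Fin N)

variable {N : ℕ}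

/-- The directional mean value operator `M^ε_ξ v (x)`. -/
def mveOp (q ε : ℝ) (v : EucN N → ℝ) (ξ x : EucN N) : ℝ :=
  q * (⨍ y in ball x ε, v y) + (1 - q) * ((v (x + ε • ξ) + v (x - ε • ξ)) / 2)

/-- The mean value operator `M^ε v (x) = sup_{|ξ|=1} M^ε_ξ v (x)`. -/
def mvOp (q ε : ℝ) (v : EucN N → ℝ) (x : EucN N) : ℝ :=
  ⨆ ξ : sphere (0 : EucN N) 1, mveOp q ε v (ξ : EucN N) x

/-- `Ω_ε = {x : dist(x,Ω) ≤ ε}`. -/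
def Oeps (Ω : Set (EucN N)) (ε : ℝ) : Set (EucN N) := {x | Metric.infDist x Ω ≤ ε}

/-- `Γ_ε = Ω_ε \ closure Ω`. -/
def Geps (Ω : Set (EucN N)) (ε : ℝ) : Set (EucN N) := Oeps Ω ε \ closure Ω

/-- `v` is an `ε`-mean value solution with boundary data `F`. -/
def IsMVS (q ε : ℝ) (Ω : Set (EucN N)) (F v : EucN N → ℝ) : Prop :=
  Measurable v ∧ (∃ C, ∀ x ∈ Oeps Ω ε, |v x| ≤ C) ∧ EqOn v F (Geps Ω ε) ∧
    LowerSemicontinuousOn v (closure Ω) ∧ ∀ x ∈ closure Ω, v x = mvOp q ε v x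

/-- exterior corkscrew condition, satisfied by bounded Lipschitz domains -/
def Corkscrew (Ω : Set (EucN N)) (δbar μ : ℝ) : Prop :=
  ∀ δ, 0 < δ → δ < δbar → ∀ y ∈ frontier Ω, ∃ z, closedBall z (μ * δ) ⊆ ball y δ \ Ω

/-- The quadratic form of the Hessian of `v` at `x` evaluated at `ξ`. -/
def hessQF (v : EucN N → ℝ) (x ξ : EucN N) : ℝ := iteratedFDeriv ℝ 2 v x ![ξ, ξ]

/-- The dominative p-Laplacian `D_p v (x) = Δv(x) + (p-2) λ_max (D²v(x))`. -/
def domLap (p : ℝ) (v : EucN N → ℝ) (x : EucN N) : ℝ :=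
  (∑ i : Fin N, hessQF v x (EuclideanSpace.single i 1)) +
    (p - 2) * ⨆ ξ : sphere (0 : EucN N) 1, hessQF v x (ξ : EucN N)

theorem integrableOn_ball_of_continuous {g : EucN N → ℝ} (hg : Continuous g) (x : EucN N)
    (r : ℝ) : IntegrableOn g (ball x r) :=
  (hg.continuousOn.integrableOn_compact (isCompact_closedBall x r)).mono_set ball_subset_closedBall

theorem setIntegral_ball_zero_comp (e : EucN N ≃ₗᵢ[ℝ] EucN N) (g : EucN N → ℝ) (r : ℝ) :
    ∫ z in ball 0 r, g (e z) = ∫ z in ball 0 r, g z := by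
  have h := e.measurePreserving.setIntegral_preimage_emb
    e.toHomeomorph.measurableEmbedding g (ball 0 r)
  have hs : e ⁻¹' ball 0 r = ball 0 r := by
    rw [e.preimage_ball, map_zero]
  rwa [hs] at h

theorem setIntegral_ball_zero_norm_sq (hN : 2 ≤ N) {r : ℝ} (hr : 0 < r) :
    ∫ z in ball (0 : EucN N) r, ‖z‖ ^ 2
      = volume.real (ball (0 : EucN N) r) * (N * (r ^ 2 / (N + 2))) := by
  have : Nontrivial (EucN N) := by
    have : Nonempty (Fin N) := ⟨⟨0, by omega⟩⟩
    infer_instance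
  have h1 : ∫ z in ball (0 : EucN N) r, ‖z‖ ^ 2
      = ∫ z : EucN N, (Iio r).indicator (fun t : ℝ => t ^ 2) ‖z‖ := by
    rw [← integral_indicator measurableSet_ball]
    congr 1
    ext z
    simp [indicator]
  rw [h1, integral_fun_norm_addHaar volume]
  have h2 : ∫ y in Ioi (0 : ℝ), y ^ (Module.finrank ℝ (EucN N) - 1) •
      (Iio r).indicator (fun t : ℝ => t ^ 2) y = r ^ (N + 2) / (N + 2) := by
    have : ∀ y : ℝ, y ^ (Module.finrank ℝ (EucN N) - 1) •
      (Iio r).indicator (fun t : ℝ => t ^ 2) y = (Iio r).indicator (fun t => t ^ (N + 1)) y := by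
      intro y
      obtain ⟨k, rfl⟩ : ∃ k, N = k + 1 := ⟨N - 1, by omega⟩
      by_cases hy : y < r
      · simp [indicator, hy]; ring
      · simp [indicator, hy]
    simp_rw [this]
    rw [setIntegral_indicator measurableSet_Iio, Ioi_inter_Iio, ← integral_Ioc_eq_integral_Ioo,
      ← intervalIntegral.integral_of_le hr.le, integral_pow]
    push_cast
    simp
    ring
  have h3 : volume.real (ball (0 : EucN N) r) = r ^ N * volume.real (ball (0 : EucN N) 1) := by
    rw [measureReal_def, Measure.addHaar_ball _ _ hr.le, ENNReal.toReal_mul,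
      ENNReal.toReal_ofReal (by positivity), finrank_euclideanSpace_fin, measureReal_def]
  rw [h2, h3, finrank_euclideanSpace_fin]
  simp
  ring

theorem setIntegral_ball_zero_mul_of_ne (r : ℝ) {i j : Fin N} (hij : i ≠ j) :
    ∫ z in ball (0 : EucN N) r, z i * z j = 0 := by
  let e : EucN N ≃ₗᵢ[ℝ] EucN N := LinearIsometryEquiv.piLpCongrRight 2
    (fun k => if k = i then LinearIsometryEquiv.neg ℝ else LinearIsometryEquiv.refl ℝ ℝ)
  have h := setIntegral_ball_zero_comp e (fun z => z i * z j) r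
  have he : ∀ z : EucN N, (e z) i * (e z) j = -(z i * z j) := by
    intro z
    simp [e, hij.symm]
  simp_rw [he, integral_neg] at h
  linarith

theorem setIntegral_ball_zero_sq_eq (r : ℝ) (i j : Fin N) :
    ∫ z in ball (0 : EucN N) r, z i * z i = ∫ z in ball (0 : EucN N) r, z j * z j := by
  let e : EucN N ≃ₗᵢ[ℝ] EucN N := LinearIsometryEquiv.piLpCongrLeft 2 ℝ ℝ (Equiv.swap i j)
  have h := setIntegral_ball_zero_comp e (fun z => z j * z j) r
  have he : ∀ z : EucN N, (e z) j * (e z) j = z i * z i := by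
    intro z
    simp [e]
  simp_rw [he] at h
  exact h

theorem setIntegral_ball_zero_sq (hN : 2 ≤ N) {r : ℝ} (hr : 0 < r) (i : Fin N) :
    ∫ z in ball (0 : EucN N) r, z i * z i
      = volume.real (ball (0 : EucN N) r) * (r ^ 2 / (N + 2)) := by
  have h := setIntegral_ball_zero_norm_sq hN hr
  simp_rw [EuclideanSpace.norm_sq_eq, Real.norm_eq_abs, sq_abs] at h
  rw [integral_finsetSum _ (fun j _ => integrableOn_ball_of_continuous (by fun_prop) 0 r)] at h
  have h2 : ∀ j : Fin N, ∫ z in ball (0 : EucN N) r, z j ^ 2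
      = ∫ z in ball (0 : EucN N) r, z i * z i := by
    intro j
    simp_rw [pow_two]
    exact setIntegral_ball_zero_sq_eq r j i
  simp_rw [h2] at h
  simp only [Finset.sum_const, Finset.card_univ, Fintype.card_fin, nsmul_eq_mul] at h
  have hN0 : (N : ℝ) ≠ 0 := by
    have : N ≠ 0 := by omega
    exact_mod_cast this
  apply mul_left_cancel₀ hN0
  rw [h]
  ring

theorem setIntegral_ball_zero_bilin (hN : 2 ≤ N) {r : ℝ} (hr : 0 < r)
    (B : EucN N →L[ℝ] EucN N →L[ℝ] ℝ) :
    ∫ z in ball (0 : EucN N) r, B z z = volume.real (ball (0 : EucN N) r) *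
      (r ^ 2 / (N + 2) * ∑ i, B (EuclideanSpace.single i 1) (EuclideanSpace.single i 1)) := by
  have hB : ∀ z : EucN N, B z z = ∑ i, ∑ j,
      B (EuclideanSpace.single i 1) (EuclideanSpace.single j 1) * (z i * z j) := by
    intro z
    have hz : z = ∑ i, z i • (EuclideanSpace.single i 1 : EucN N) := by
      ext k
      simp [Finset.sum_apply, Pi.single_apply]
    conv_lhs => rw [hz]
    simp only [map_sum, map_smul, sum_apply, smul_apply,
      smul_eq_mul]
    rw [Finset.sum_comm]
    simp only [Finset.mul_sum]
    refine Finset.sum_congr rfl fun i _ => Finset.sum_congr rfl fun j _ => ?_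
    ring
  rw [funext hB]
  rw [integral_finsetSum _ (fun j _ => integrableOn_ball_of_continuous (by fun_prop) 0 r)]
  rw [Finset.mul_sum, Finset.mul_sum]
  refine Finset.sum_congr rfl fun i _ => ?_
  rw [integral_finsetSum _ (fun j _ => integrableOn_ball_of_continuous (by fun_prop) 0 r)]
  rw [Finset.sum_eq_single i]
  · rw [integral_const_mul, setIntegral_ball_zero_sq hN hr]
    ring
  · intro j _ hj
    rw [integral_const_mul, setIntegral_ball_zero_mul_of_ne r hj.symm, mul_zero]
  · simp

theorem setIntegral_ball_zero_clm (L : EucN N →L[ℝ] ℝ) (r : ℝ) :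
    ∫ z in ball (0 : EucN N) r, L z = 0 := by
  have h := setIntegral_ball_zero_comp (LinearIsometryEquiv.neg ℝ) (fun z => L z) r
  simp only [LinearIsometryEquiv.coe_neg, map_neg, integral_neg] at h
  linarith

theorem setAverage_ball_quadratic (hN : 2 ≤ N) {r : ℝ} (hr : 0 < r) (x : EucN N) (a : ℝ)
    (L : EucN N →L[ℝ] ℝ) (B : EucN N →L[ℝ] EucN N →L[ℝ] ℝ) :
    ⨍ y in ball x r, (a + L (y - x) + B (y - x) (y - x))
      = a + r ^ 2 / (N + 2) *
        ∑ i, B (EuclideanSpace.single i 1) (EuclideanSpace.single i 1) := by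
  have hv : volume.real (ball (0 : EucN N) r) ≠ 0 := by
    rw [measureReal_def]
    exact (ENNReal.toReal_pos (measure_ball_pos volume _ hr).ne' measure_ball_lt_top.ne).ne'
  have h := (measurePreserving_sub_right volume x).setIntegral_preimage_emb
    (measurableEmbedding_subRight x) (fun z => a + L z + B z z) (ball (0 : EucN N) r)
  have hs : (fun y => y - x) ⁻¹' ball (0 : EucN N) r = ball x r := by
    ext y
    simp [dist_eq_norm]
  rw [hs] at h
  have hvx : volume.real (ball x r) = volume.real (ball (0 : EucN N) r) := by
    simp [measureReal_def, Measure.addHaar_ball_center]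
  rw [setAverage_eq, h, hvx,
    integral_add (integrableOn_ball_of_continuous (by fun_prop) 0 r)
      (integrableOn_ball_of_continuous (by fun_prop) 0 r),
    integral_add (integrableOn_ball_of_continuous (by fun_prop) 0 r)
      (integrableOn_ball_of_continuous (by fun_prop) 0 r),
    setIntegral_ball_zero_clm, setIntegral_ball_zero_bilin hN hr, setIntegral_const, smul_eq_mul,
    smul_eq_mul]
  field_simp
  ring

theorem mveOp_quadratic (hN : 2 ≤ N) {ε : ℝ} (hε : 0 < ε) (q : ℝ) (ξ x : EucN N) (a : ℝ)
    (L : EucN N →L[ℝ] ℝ) (B : EucN N →L[ℝ] EucN N →L[ℝ] ℝ) :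
    mveOp q ε (fun y => a + L (y - x) + B (y - x) (y - x)) ξ x
      = a + ε ^ 2 * (q / (N + 2) *
        ∑ i, B (EuclideanSpace.single i 1) (EuclideanSpace.single i 1) + (1 - q) * B ξ ξ) := by
  unfold mveOp
  rw [setAverage_ball_quadratic hN hε]
  simp
  ring

theorem mveOp_le_add {q ε m : ℝ} (hq0 : 0 ≤ q) (hq1 : q ≤ 1) (hε : 0 < ε) {u v : EucN N → ℝ}
    {ξ x : EucN N} (hξ : ‖ξ‖ = 1) (hu : IntegrableOn u (ball x ε)) (hv : IntegrableOn v (ball x ε))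
    (h : ∀ y ∈ closedBall x ε, u y ≤ v y + m) : mveOp q ε u ξ x ≤ mveOp q ε v ξ x + m := by
  have hpos : 0 < volume.real (ball x ε) := by
    rw [measureReal_def]
    exact ENNReal.toReal_pos (measure_ball_pos volume _ hε).ne' measure_ball_lt_top.ne
  have h1 : ⨍ y in ball x ε, u y ≤ (⨍ y in ball x ε, v y) + m := by
    have hc : IntegrableOn (fun _ => m) (ball x ε) := integrableOn_ball_of_continuous (by fun_prop) x ε
    have h2 := setIntegral_mono_on hu (hv.add hc) measurableSet_ball
      (fun y hy => h y (ball_subset_closedBall hy))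
    simp only [Pi.add_apply] at h2
    rw [integral_add hv hc, setIntegral_const, smul_eq_mul] at h2
    rw [setAverage_eq, setAverage_eq, smul_eq_mul, smul_eq_mul]
    calc _ ≤ (volume.real (ball x ε))⁻¹ * (_ + volume.real (ball x ε) * m) := by gcongr
      _ = _ := by field_simp
  have hnorm : ‖ε • ξ‖ ≤ ε := by rw [norm_smul, hξ, Real.norm_of_nonneg hε.le, mul_one]
  have h3 := h (x + ε • ξ) (by simpa [dist_eq_norm] using hnorm)
  have h4 := h (x - ε • ξ) (by simpa [dist_eq_norm] using hnorm)
  unfold mveOp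
  have h5 := mul_le_mul_of_nonneg_left h1 hq0
  have h6 := mul_le_mul_of_nonneg_left (add_le_add h3 h4) (sub_nonneg.2 hq1)
  linarith

theorem abs_sub_quadratic_le {E : Type*} [NormedAddCommGroup E] [NormedSpace ℝ E] {f : E → ℝ}
    {f₁ : E → E →L[ℝ] ℝ} {f₂ : E → E →L[ℝ] E →L[ℝ] ℝ} {x : E} {r K : ℝ} (hr : 0 ≤ r) (hK : 0 ≤ K)
    (h₁ : ∀ y ∈ closedBall x r, HasFDerivAt f (f₁ y) y)
    (h₂ : ∀ y ∈ closedBall x r, HasFDerivAt f₁ (f₂ y) y)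
    (hf₂ : ∀ y ∈ closedBall x r, ‖f₂ y - f₂ x‖ ≤ K * ‖y - x‖)
    (hsymm : ∀ v w, f₂ x v w = f₂ x w v) {y : E} (hy : y ∈ closedBall x r) :
    |f y - (f x + f₁ x (y - x) + (2 : ℝ)⁻¹ • f₂ x (y - x) (y - x))| ≤ K * r ^ 3 := by
  have hx : x ∈ closedBall x r := mem_closedBall_self hr
  have hdist : ∀ y ∈ closedBall x r, ‖y - x‖ ≤ r := fun y hy => by
    rwa [← dist_eq_norm]
  have hfirst : ∀ y ∈ closedBall x r, ‖f₁ y - f₁ x - f₂ x (y - x)‖ ≤ K * r ^ 2 := by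
    intro y hy
    have := (convex_closedBall x r).norm_image_sub_le_of_norm_hasFDerivWithin_le' (φ := f₂ x)
      (C := K * r) (fun z hz => (h₂ z hz).hasFDerivWithinAt)
      (fun z hz => (hf₂ z hz).trans (by gcongr; exact hdist z hz)) hx hy
    refine this.trans ?_
    calc K * r * ‖y - x‖ ≤ K * r * r := by gcongr; exact hdist y hy
      _ = _ := by ring
  have hrem : ∀ y ∈ closedBall x r, HasFDerivAt
      (fun y => f y - (f x + f₁ x (y - x) + (2 : ℝ)⁻¹ • f₂ x (y - x) (y - x)))
      (f₁ y - f₁ x - f₂ x (y - x)) y := by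
    intro y hy
    have hsub : HasFDerivAt (fun y => y - x) (ContinuousLinearMap.id ℝ E) y :=
      (hasFDerivAt_id y).sub_const x
    have hlin := (f₁ x).hasFDerivAt.comp y hsub
    have hquad := (((f₂ x).hasFDerivAt.comp y hsub).clm_apply hsub).const_smul (2 : ℝ)⁻¹
    refine ((h₁ y hy).sub ((hlin.const_add (f x)).add hquad)).congr_fderiv ?_
    ext v
    simp [hsymm v y, hsymm v x]
    ring
  have := (convex_closedBall x r).norm_image_sub_le_of_norm_hasFDerivWithin_le
    (fun z hz => (hrem z hz).hasFDerivWithinAt) hfirst hx hy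
  simp only [sub_self, map_zero, smul_zero, add_zero,
    sub_zero, Real.norm_eq_abs] at this
  refine this.trans ?_
  calc K * r ^ 2 * ‖y - x‖ ≤ K * r ^ 2 * r := by gcongr; exact hdist y hy
    _ = _ := by ring

theorem abs_mveOp_add_norm_sq_sub_le (hN : 2 ≤ N) {q ε E s : ℝ} (hq0 : 0 ≤ q) (hq1 : q ≤ 1)
    (hε : 0 < ε) {w : EucN N → ℝ} {ξ x : EucN N} (hξ : ‖ξ‖ = 1)
    (hw : IntegrableOn w (ball x ε)) (L : EucN N →L[ℝ] ℝ) (B : EucN N →L[ℝ] EucN N →L[ℝ] ℝ)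
    (hE : ∀ y ∈ closedBall x ε,
      |w y - (w x + L (y - x) + (2 : ℝ)⁻¹ • B (y - x) (y - x))| ≤ E) :
    |mveOp q ε (fun y => w y + s * ‖y‖ ^ 2) ξ x - (w x + s * ‖x‖ ^ 2 + ε ^ 2 * (q / (N + 2) *
      ∑ i, ((2 : ℝ)⁻¹ * B (EuclideanSpace.single i 1) (EuclideanSpace.single i 1) + s)
      + (1 - q) * ((2 : ℝ)⁻¹ * B ξ ξ + s)))| ≤ E := by
  let I : EucN N →L[ℝ] EucN N →L[ℝ] ℝ := innerSL ℝ
  have hI : ∀ z, I z z = ‖z‖ ^ 2 := real_inner_self_eq_norm_sq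
  set P : EucN N → ℝ := fun y => (w x + s * ‖x‖ ^ 2) + (L + (2 * s) • innerSL ℝ x) (y - x)
    + ((2 : ℝ)⁻¹ • B + s • I) (y - x) (y - x) with hP
  have hquad := mveOp_quadratic hN hε q ξ x (w x + s * ‖x‖ ^ 2) (L + (2 * s) • innerSL ℝ x)
    ((2 : ℝ)⁻¹ • B + s • I)
  have hdiff : ∀ y, w y + s * ‖y‖ ^ 2 - P y
      = w y - (w x + L (y - x) + (2 : ℝ)⁻¹ • B (y - x) (y - x)) := by
    intro y
    have h := norm_add_sq_real x (y - x)
    rw [add_sub_cancel] at h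
    simp only [hP, add_apply, smul_apply, smul_eq_mul, innerSL_apply_apply, h,
      hI]
    ring
  have hPi : IntegrableOn P (ball x ε) :=
    integrableOn_ball_of_continuous (by fun_prop) x ε
  have hwi : IntegrableOn (fun y => w y + s * ‖y‖ ^ 2) (ball x ε) :=
    hw.add (integrableOn_ball_of_continuous (by fun_prop) x ε)
  have hup := mveOp_le_add (m := E) hq0 hq1 hε hξ hwi hPi (fun y hy => by
    have := (abs_le.1 (hE y hy)).2
    rw [← hdiff] at this
    linarith)
  have hlo := mveOp_le_add (m := E) hq0 hq1 hε hξ hPi hwi (fun y hy => by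
    have := (abs_le.1 (hE y hy)).1
    rw [← hdiff] at this
    linarith)
  rw [hquad] at hup hlo
  simp only [add_apply, smul_apply, smul_eq_mul, hI, hξ, PiLp.norm_single, norm_one, one_pow,
    mul_one] at hup hlo
  rw [abs_le]
  constructor <;> linarith

/-- If `u` is bounded above on `S`, at most `b` on `S \ T`, and every upper bound of `u` on `S`
can be improved by a fixed `η > 0` on `T`, then `u ≤ b` on `S`. -/
theorem le_of_improvable_bound {α : Type*} {S T : Set α} {u : α → ℝ} {b η : ℝ} (hη : 0 < η)
    (hbdd : BddAbove (u '' S)) (hb : ∀ x ∈ S \ T, u x ≤ b)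
    (himp : ∀ m, (∀ y ∈ S, u y ≤ m) → ∀ x ∈ T, u x ≤ m - η) : ∀ x ∈ S, u x ≤ b := by
  intro x hx
  by_contra! hlt
  have hle : ∀ y ∈ S, u y ≤ sSup (u '' S) := fun y hy => le_csSup hbdd (mem_image_of_mem u hy)
  have hmax : sSup (u '' S) ≤ max b (sSup (u '' S) - η) := by
    refine csSup_le ⟨_, mem_image_of_mem u hx⟩ ?_
    rintro _ ⟨y, hy, rfl⟩
    by_cases hyT : y ∈ T
    · exact le_max_of_le_right (himp _ hle y hyT)
    · exact le_max_of_le_left (hb y ⟨hy, hyT⟩)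
  have := hle x hx
  rcases le_max_iff.1 hmax with h | h <;> linarith

theorem closedBall_subset_Oeps {Ω : Set (EucN N)} (hΩ : Ω.Nonempty) {ε : ℝ} {x : EucN N}
    (hx : x ∈ closure Ω) : closedBall x ε ⊆ Oeps Ω ε := by
  intro y hy
  have h0 := (mem_closure_iff_infDist_zero hΩ).1 hx
  have h1 : infDist y Ω ≤ infDist x Ω + dist y x := infDist_le_infDist_add_dist
  have h2 : dist y x ≤ ε := hy
  simp only [Oeps, mem_ofPred_eq]
  linarith

theorem isCompact_Oeps {Ω : Set (EucN N)} (hΩ : Ω.Nonempty) (hΩb : Bornology.IsBounded Ω)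
    (ε : ℝ) : IsCompact (Oeps Ω ε) := by
  refine isCompact_of_isClosed_isBounded (isClosed_le (continuous_infDist_pt Ω) continuous_const) ?_
  refine (hΩb.cthickening (δ := ε)).subset fun x hx => ?_
  rw [cthickening_eq_preimage_infEDist]
  rw [mem_preimage, mem_Iic, ← ENNReal.ofReal_toReal (infEDist_ne_top hΩ)]
  exact ENNReal.ofReal_le_ofReal hx

theorem closure_subset_interior_Oeps {Ω : Set (EucN N)} (hΩ : Ω.Nonempty) {ε : ℝ} (hε : 0 < ε) :
    closure Ω ⊆ interior (Oeps Ω ε) := fun _ hx =>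
  mem_interior_iff_mem_nhds.2 <|
    Filter.mem_of_superset (closedBall_mem_nhds _ hε) (closedBall_subset_Oeps hΩ hx)

theorem exists_bound_fderiv {E F : Type*} [NormedAddCommGroup E] [NormedSpace ℝ E]
    [NormedAddCommGroup F] [NormedSpace ℝ F] {f : E → F} {V S : Set E} (hVo : IsOpen V)
    (hf : ContDiffOn ℝ 1 f V) (hS : IsCompact S) (hSV : S ⊆ V) :
    ∃ K, ∀ x ∈ S, ‖fderiv ℝ f x‖ ≤ K :=
  hS.exists_bound_of_continuousOn ((hf.continuousOn_fderiv_of_isOpen hVo le_rfl).mono hSV)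

theorem exists_abs_sub_taylor_two_le {w : EucN N → ℝ} {V S : Set (EucN N)} (hVo : IsOpen V)
    (hw : ContDiffOn ℝ 3 w V) (hS : IsCompact S) (hSV : S ⊆ V) :
    ∃ K, 0 ≤ K ∧ ∀ x r, 0 ≤ r → closedBall x r ⊆ S → ∀ y ∈ closedBall x r,
      |w y - (w x + fderiv ℝ w x (y - x) +
        (2 : ℝ)⁻¹ • fderiv ℝ (fderiv ℝ w) x (y - x) (y - x))| ≤ K * r ^ 3 := by
  have h1 : ContDiffOn ℝ 2 (fderiv ℝ w) V := hw.fderiv_of_isOpen hVo (by norm_num)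
  have h2 : ContDiffOn ℝ 1 (fderiv ℝ (fderiv ℝ w)) V := h1.fderiv_of_isOpen hVo (by norm_num)
  obtain ⟨K, hK⟩ := exists_bound_fderiv hVo h2 hS hSV
  refine ⟨max K 0, le_max_right _ _, fun x r hr hball y hy => ?_⟩
  have hV : closedBall x r ⊆ V := hball.trans hSV
  have hderiv : ∀ {F : Type} [NormedAddCommGroup F] [NormedSpace ℝ F] {n : WithTop ℕ∞}
      {f : EucN N → F}, ContDiffOn ℝ n f V → n ≠ 0 → ∀ z ∈ closedBall x r,
      HasFDerivAt f (fderiv ℝ f z) z := fun hf hn z hz =>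
    ((hf.contDiffAt (hVo.mem_nhds (hV hz))).differentiableAt hn).hasFDerivAt
  have hx : x ∈ closedBall x r := mem_closedBall_self hr
  refine abs_sub_quadratic_le hr (le_max_right _ _) (hderiv hw (by norm_num))
    (hderiv h1 (by norm_num)) (fun z hz => ?_) ?_ hy
  · exact (convex_closedBall x r).norm_image_sub_le_of_norm_hasFDerivWithin_le
      (fun z hz => (hderiv h2 (by norm_num) z hz).hasFDerivWithinAt)
      (fun z hz => (hK z (hball hz)).trans (le_max_left _ _)) hx hz
  · exact (hw.contDiffAt (hVo.mem_nhds (hV hx))).isSymmSndFDerivAt (by simp; norm_num)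

theorem bddAbove_range_hessQF (w : EucN N → ℝ) (x : EucN N) :
    BddAbove (range fun ξ : sphere (0 : EucN N) 1 => hessQF w x ξ) := by
  refine ⟨‖iteratedFDeriv ℝ 2 w x‖, ?_⟩
  rintro _ ⟨ξ, rfl⟩
  have hξ : ‖(ξ : EucN N)‖ = 1 := norm_eq_of_mem_sphere ξ
  have h := (iteratedFDeriv ℝ 2 w x).le_opNorm ![(ξ : EucN N), ξ]
  simp only [Fin.prod_univ_two, Matrix.cons_val_zero, Matrix.cons_val_one, hξ, mul_one] at h
  exact (le_abs_self _).trans h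

theorem exists_hessQF_eq_iSup [Nonempty (sphere (0 : EucN N) 1)] (w : EucN N → ℝ) (x : EucN N) :
    ∃ ξ : sphere (0 : EucN N) 1, hessQF w x ξ = ⨆ ζ : sphere (0 : EucN N) 1, hessQF w x ζ := by
  have hc : Continuous fun ξ : sphere (0 : EucN N) 1 => hessQF w x ξ := by
    simp only [hessQF, iteratedFDeriv_two_apply, Matrix.cons_val_zero, Matrix.cons_val_one]
    fun_prop
  obtain ⟨ξ, -, hξ⟩ := isCompact_univ.exists_isMaxOn univ_nonempty hc.continuousOn
  exact ⟨ξ, le_antisymm (le_ciSup (bddAbove_range_hessQF w x) ξ)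
    (ciSup_le fun ζ => hξ (mem_univ ζ))⟩

/-- For `D_p w = 0`, the perturbation `w + s |·|²` has mean values `w + s |·|² + c s ε²` up to the
Taylor remainder, as an upper bound in all directions and as a lower bound in some direction. -/
theorem mveOp_add_norm_sq_of_domLap_eq_zero (hN : 2 ≤ N) {p q : ℝ} (hp : 2 ≤ p)
    (hq : q = ((N : ℝ) + 2) / ((N : ℝ) + p)) {ε E s : ℝ} (hε : 0 < ε) {w : EucN N → ℝ}
    {x : EucN N} (hw : IntegrableOn w (ball x ε)) (hdom : domLap p w x = 0)
    (hE : ∀ y ∈ closedBall x ε, |w y - (w x + fderiv ℝ w x (y - x) +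
      (2 : ℝ)⁻¹ • fderiv ℝ (fderiv ℝ w) x (y - x) (y - x))| ≤ E)
    [Nonempty (sphere (0 : EucN N) 1)] :
    (∀ ξ : sphere (0 : EucN N) 1, mveOp q ε (fun y => w y + s * ‖y‖ ^ 2) ξ x ≤
      w x + s * ‖x‖ ^ 2 + ε ^ 2 * (s * ((N + p - 2) / (N + p))) + E) ∧
    ∃ ξ : sphere (0 : EucN N) 1, w x + s * ‖x‖ ^ 2 + ε ^ 2 * (s * ((N + p - 2) / (N + p))) - E ≤
      mveOp q ε (fun y => w y + s * ‖y‖ ^ 2) ξ x := by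
  have hNp : 0 < (N : ℝ) + p := by positivity
  have hq0 : 0 ≤ q := by rw [hq]; positivity
  have hq1 : q ≤ 1 := by rw [hq, div_le_one hNp]; linarith
  have hess : ∀ ξ, fderiv ℝ (fderiv ℝ w) x ξ ξ = hessQF w x ξ := fun ξ => by
    simp [hessQF, iteratedFDeriv_two_apply]
  have hmain : ∀ ξ : sphere (0 : EucN N) 1,
      |mveOp q ε (fun y => w y + s * ‖y‖ ^ 2) ξ x - (w x + s * ‖x‖ ^ 2 +
        ε ^ 2 * ((p - 2) / (2 * (N + p)) * (hessQF w x ξ - ⨆ ζ : sphere (0 : EucN N) 1,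
          hessQF w x ζ) + s * ((N + p - 2) / (N + p))))| ≤ E := by
    intro ξ
    have h := abs_mveOp_add_norm_sq_sub_le (s := s) hN hq0 hq1 hε (norm_eq_of_mem_sphere ξ) hw
      (fderiv ℝ w x) (fderiv ℝ (fderiv ℝ w) x) hE
    simp only [hess, Finset.sum_add_distrib, ← Finset.mul_sum, Finset.sum_const, Finset.card_univ,
      Fintype.card_fin, nsmul_eq_mul] at h
    unfold domLap at hdom
    rw [eq_neg_of_add_eq_zero_left hdom, hq] at h
    convert h using 4
    have : (N : ℝ) + 2 ≠ 0 := by positivity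
    field_simp
    ring
  refine ⟨fun ξ => ?_, ?_⟩
  · have h1 := (abs_le.1 (hmain ξ)).2
    have h2 : ε ^ 2 * ((p - 2) / (2 * (N + p)) * (hessQF w x ξ - ⨆ ζ : sphere (0 : EucN N) 1,
        hessQF w x ζ)) ≤ 0 :=
      mul_nonpos_of_nonneg_of_nonpos (by positivity) <|
        mul_nonpos_of_nonneg_of_nonpos (div_nonneg (by linarith) (by positivity)) <|
          sub_nonpos.2 (le_ciSup (bddAbove_range_hessQF w x) ξ)
    linarith
  · obtain ⟨ξ, hξ⟩ := exists_hessQF_eq_iSup w x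
    have h1 := (abs_le.1 (hmain ξ)).1
    rw [hξ, sub_self, mul_zero, zero_add] at h1
    exact ⟨ξ, by linarith⟩

theorem bddAbove_range_mveOp {q ε C : ℝ} (hq0 : 0 ≤ q) (hq1 : q ≤ 1) (hε : 0 < ε)
    {u : EucN N → ℝ} {x : EucN N} (hu : IntegrableOn u (ball x ε))
    (hC : ∀ y ∈ closedBall x ε, u y ≤ C) :
    BddAbove (range fun ξ : sphere (0 : EucN N) 1 => mveOp q ε u ξ x) := by
  refine ⟨C, ?_⟩
  rintro _ ⟨ξ, rfl⟩
  have h := mveOp_le_add (v := fun _ => 0) (m := C) hq0 hq1 hε (norm_eq_of_mem_sphere ξ) hu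
    (integrableOn_ball_of_continuous continuous_const x ε) (by simpa using hC)
  simpa [mveOp] using h

/-- for `w` three times continuously differentiable near `Ω_{ε'}` with
`D_p w = 0` in the interior of `Ω_{ε'}`, the ε-mean value solutions with boundary data
`w` on `Γ_ε` satisfy `|w - w_ε| ≤ C₂ ε` on `closure Ω`, uniformly in `0 < ε ≤ ε'`. -/
theorem smooth_rate (hN : 2 ≤ N) (p q : ℝ) (hp : 2 ≤ p)
    (hq : q = ((N : ℝ) + 2) / ((N : ℝ) + p))
    (Ω : Set (EucN N)) (hΩo : IsOpen Ω) (hΩb : Bornology.IsBounded Ω)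
    (hΩc : IsConnected Ω) (δbar μ : ℝ) (hδbar : 0 < δbar) (hμ : μ ∈ Ioo (0 : ℝ) 1)
    (hΩlip : Corkscrew Ω δbar μ)
    (ε' : ℝ) (hε' : 0 < ε')
    (V : Set (EucN N)) (hVo : IsOpen V) (hV : Oeps Ω ε' ⊆ V)
    (w : EucN N → ℝ) (hw : ContDiffOn ℝ 3 w V)
    (hwsol : ∀ x ∈ interior (Oeps Ω ε'), domLap p w x = 0) :
    ∃ C₂ > 0, ∀ ε : ℝ, 0 < ε → ε ≤ ε' →
      ∀ wε : EucN N → ℝ, IsMVS q ε Ω w wε →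
        ∀ x ∈ closure Ω, |w x - wε x| ≤ C₂ * ε := by
  have hΩ : Ω.Nonempty := hΩc.nonempty
  have hNp : 0 < (N : ℝ) + p := by positivity
  have hq0 : 0 ≤ q := by rw [hq]; positivity
  have hq1 : q ≤ 1 := by rw [hq, div_le_one hNp]; linarith
  have hN2 : (2 : ℝ) ≤ N := by exact_mod_cast hN
  have hc : 1 / 2 ≤ ((N : ℝ) + p - 2) / (N + p) := by
    rw [div_le_div_iff₀ two_pos hNp]
    linarith
  have : Nonempty (Fin N) := ⟨⟨0, by omega⟩⟩
  have : Nonempty (sphere (0 : EucN N) 1) :=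
    (NormedSpace.sphere_nonempty.2 zero_le_one).to_subtype
  have hcomp := isCompact_Oeps hΩ hΩb ε'
  obtain ⟨K, hK0, hK⟩ := exists_abs_sub_taylor_two_le hVo hw hcomp hV
  obtain ⟨R, hR⟩ := hcomp.isBounded.exists_norm_le
  obtain ⟨W, hW⟩ := hcomp.exists_bound_of_continuousOn (hw.continuousOn.mono hV)
  refine ⟨2 * (K + 1) * R ^ 2 + 1, by positivity, fun ε hε hεε' wε hwε x hx => ?_⟩
  obtain ⟨hmeas, ⟨C, hC⟩, hbdry, -, hfix⟩ := hwε
  set κ : ℝ := 2 * (K + 1) with hκ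
  have hκ0 : 0 ≤ κ := by positivity
  have hsub : Oeps Ω ε ⊆ Oeps Ω ε' := fun y hy => le_trans hy hεε'
  have hball : ∀ y ∈ closure Ω, closedBall y ε ⊆ Oeps Ω ε := fun y hy =>
    closedBall_subset_Oeps hΩ hy
  have hwint : ∀ y ∈ closure Ω, IntegrableOn w (ball y ε) := fun y hy =>
    ((hw.continuousOn.mono (((hball y hy).trans hsub).trans hV)).integrableOn_compact
      (isCompact_closedBall y ε)).mono_set ball_subset_closedBall
  have hwεint : ∀ y ∈ closure Ω, IntegrableOn wε (ball y ε) := fun y hy =>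
    Measure.integrableOn_of_bounded measure_ball_lt_top.ne hmeas.aestronglyMeasurable
      (M := C) ((ae_restrict_iff' measurableSet_ball).2 <| Filter.Eventually.of_forall fun z hz =>
        hC z (hball y hy (ball_subset_closedBall hz)))
  have hvint : ∀ (s : ℝ), ∀ y ∈ closure Ω, IntegrableOn (fun z => w z + s * ‖z‖ ^ 2) (ball y ε) :=
    fun s y hy => (hwint y hy).add (integrableOn_ball_of_continuous (by fun_prop) y ε)
  have hsq : ∀ y ∈ Oeps Ω ε, κ * ε * ‖y‖ ^ 2 ≤ κ * ε * R ^ 2 := fun y hy => by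
    have := hR y (hsub hy)
    gcongr
  have hcons := fun (s : ℝ) (y : EucN N) (hy : y ∈ closure Ω) =>
    mveOp_add_norm_sq_of_domLap_eq_zero (s := s) hN hp hq hε (hwint y hy)
      (hwsol y (closure_subset_interior_Oeps hΩ hε' hy))
      (hK y ε hε.le ((hball y hy).trans hsub))
  have hgain : K * ε ^ 3 + ε ^ 3 ≤ ε ^ 2 * (κ * ε * ((N + p - 2) / (N + p))) := by
    calc K * ε ^ 3 + ε ^ 3 = ε ^ 2 * (κ * ε * (1 / 2)) := by rw [hκ]; ring
      _ ≤ _ := by gcongr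
  have hupper : ∀ y ∈ Oeps Ω ε, wε y - (w y + -(κ * ε) * ‖y‖ ^ 2) ≤ κ * ε * R ^ 2 := by
    refine le_of_improvable_bound (T := closure Ω) (η := ε ^ 3) (by positivity) ?_ ?_ ?_
    · refine ⟨C + W + κ * ε * R ^ 2, ?_⟩
      rintro _ ⟨y, hy, rfl⟩
      have h1 := (abs_le.1 (hC y hy)).2
      have h2 := (abs_le.1 (hW y (hsub hy))).1
      have h3 := hsq y hy
      linarith
    · intro y hy
      rw [hbdry hy]
      linarith [hsq y hy.1]
    · intro m hm y hy
      have h : wε y ≤ w y + -(κ * ε) * ‖y‖ ^ 2 + m - ε ^ 3 := by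
        rw [hfix y hy]
        refine ciSup_le fun ξ => ?_
        have h1 := mveOp_le_add (m := m) hq0 hq1 hε (norm_eq_of_mem_sphere ξ) (hwεint y hy)
          (hvint (-(κ * ε)) y hy) (fun z hz => by linarith [hm z (hball y hy hz)])
        have h2 := (hcons (-(κ * ε)) y hy).1 ξ
        linarith
      linarith
  have hlower : ∀ y ∈ Oeps Ω ε, (w y + κ * ε * ‖y‖ ^ 2) - wε y ≤ κ * ε * R ^ 2 := by
    refine le_of_improvable_bound (T := closure Ω) (η := ε ^ 3) (by positivity) ?_ ?_ ?_
    · refine ⟨C + W + κ * ε * R ^ 2, ?_⟩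
      rintro _ ⟨y, hy, rfl⟩
      have h1 := (abs_le.1 (hC y hy)).1
      have h2 := (abs_le.1 (hW y (hsub hy))).2
      have h3 := hsq y hy
      linarith
    · intro y hy
      rw [hbdry hy]
      linarith [hsq y hy.1]
    · intro m hm y hy
      obtain ⟨ξ, h2⟩ := (hcons (κ * ε) y hy).2
      have h1 := mveOp_le_add (m := m) hq0 hq1 hε (norm_eq_of_mem_sphere ξ)
        (hvint (κ * ε) y hy) (hwεint y hy) (fun z hz => by linarith [hm z (hball y hy hz)])
      have h3 : mveOp q ε wε ξ y ≤ wε y := by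
        rw [hfix y hy]
        exact le_ciSup (bddAbove_range_mveOp hq0 hq1 hε (hwεint y hy)
          (fun z hz => (abs_le.1 (hC z (hball y hy hz))).2)) ξ
      linarith
  have hxS : x ∈ Oeps Ω ε := hball x hx (mem_closedBall_self hε.le)
  have h1 := hupper x hxS
  have h2 := hlower x hxS
  have h3 : 0 ≤ κ * ε * ‖x‖ ^ 2 := by positivity
  rw [abs_le]
  constructor <;> linarith

end
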